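/- The pipe dream complex PD(1 n (n-1) ... 2) is geometrically realized by the canonical triangulation of the vertex figure V(P_n) of the root polytope P(P_n) at the vertex 0: the map G sending a pipe dream P to the graph on [n] with edges {(i,j) : P has an elbow in box (n-j+1, i)} is a bijection from reduced pipe dreams of 1 n (n-1) ... 2 to noncrossing alternating spanning trees of K_n, and it induces a simplicial isomorphism between PD(1 n (n-1) ... 2) and the canonical triangulation of V(P_n). -/

import Mathlib

/-!  Pipe dreams and Grothendieck polynomials.  Permutations of `S_n` are modeled as
permutations of `ℕ` fixing every `i ≥ n` (acting on `{0,…,n-1}`). -/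

attribute [local instance] Classical.propDecidable

/-- Coxeter length = number of inversions on `{0,…,n-1}`. -/
def permLen (n : ℕ) (w : Equiv.Perm ℕ) : ℕ :=
  ((Finset.range n ×ˢ Finset.range n).filter (fun p => p.1 < p.2 ∧ w p.2 < w p.1)).card

/-- Boxes of the staircase shape (0-indexed): `(r,c)` with `r + c ≤ n - 2`. -/
def boxes (n : ℕ) : Finset (ℕ × ℕ) :=
  ((Finset.range n) ×ˢ (Finset.range n)).filter (fun b => b.1 + b.2 + 2 ≤ n)

/-- The triangular word, as the list of boxes read row by row, each row right to left.
The box `(r,c)` carries the simple reflection `s_{r+c}` (0-indexed). -/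
def triWord (n : ℕ) : List (ℕ × ℕ) :=
  (List.range (n - 1)).flatMap (fun r => ((List.range (n - 1 - r)).reverse).map (fun c => (r, c)))

/-- Demazure (0-Hecke) product of the simple reflections sitting in the boxes of `S`,
read along the triangular word. -/
noncomputable def demazure (n : ℕ) (S : Finset (ℕ × ℕ)) : Equiv.Perm ℕ :=
  ((triWord n).filter (fun b => decide (b ∈ S))).foldl
    (fun u b =>
      let v := u * Equiv.swap (b.1 + b.2) (b.1 + b.2 + 1)
      if permLen n u < permLen n v then v else u) 1

/-- A (possibly nonreduced) pipe dream for `w ∈ S_n`: a set of crosses in the staircase whose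
pipes intertwine according to `w` (extra crossings of a pair of pipes being ignored). -/
def IsPipeDream (n : ℕ) (w : Equiv.Perm ℕ) (P : Finset (ℕ × ℕ)) : Prop :=
  P ⊆ boxes n ∧ demazure n P = w

/-- A reduced pipe dream: a pipe dream with exactly `ℓ(w)` crosses. -/
def IsReducedPipeDream (n : ℕ) (w : Equiv.Perm ℕ) (P : Finset (ℕ × ℕ)) : Prop :=
  IsPipeDream n w P ∧ P.card = permLen n w

/-- All pipe dreams of `w` (reduced and nonreduced), as a finite set. -/
noncomputable def pipeDreams (n : ℕ) (w : Equiv.Perm ℕ) : Finset (Finset (ℕ × ℕ)) :=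
  (boxes n).powerset.filter (fun P => demazure n P = w)

/-- The permutation `1 n (n-1) ⋯ 2 ∈ S_n` (0-indexed: `0 ↦ 0` and `i ↦ n - i` for
`1 ≤ i ≤ n-1`, identity elsewhere). -/
def piPerm (n : ℕ) : Equiv.Perm ℕ :=
  Function.Involutive.toPerm (fun i => if 1 ≤ i ∧ i < n then n - i else i)
    (by intro i; dsimp only; split_ifs <;> omega)

/-- The simple graph on `ℕ` with the given (increasingly oriented) edge set. -/
def graphOf (E : Finset (ℕ × ℕ)) : SimpleGraph ℕ :=
  SimpleGraph.fromEdgeSet ↑(E.image (fun p => s(p.1, p.2)))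

/-- `E` is the edge set of a spanning tree of the complete graph on `{0,…,n-1}`:
all edges are increasingly oriented edges on `{0,…,n-1}`, the graph is acyclic, and any two
vertices of `{0,…,n-1}` are connected. -/
def IsSpanningTree (n : ℕ) (E : Finset (ℕ × ℕ)) : Prop :=
  (∀ p ∈ E, p.1 < p.2 ∧ p.2 < n) ∧ (graphOf E).IsAcyclic ∧
    ∀ a b, a < n → b < n → (graphOf E).Reachable a b

/-- A graph is noncrossing if there are no vertices `i < j < k < l` with both `(i,k)` and
`(j,l)` edges. -/
def Noncrossing (E : Finset (ℕ × ℕ)) : Prop :=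
  ¬ ∃ i j k l, i < j ∧ j < k ∧ k < l ∧ (i, k) ∈ E ∧ (j, l) ∈ E

/-- A graph is alternating if there are no vertices `i < j < k` with both `(i,j)` and
`(j,k)` edges. -/
def Alternating (E : Finset (ℕ × ℕ)) : Prop :=
  ¬ ∃ i j k, i < j ∧ j < k ∧ (i, j) ∈ E ∧ (j, k) ∈ E



/-- The map sending a box of the staircase to an edge of `K_n`: 0-indexed, the box
`(r,c)` goes to the edge `(c, n - 1 - r)` (1-indexed: the box `(a,b)` carries the edge
`(i,j)` iff `a = n - j + 1` and `b = i`). -/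
def boxEdge (n : ℕ) (b : ℕ × ℕ) : ℕ × ℕ := (b.2, n - 1 - b.1)

/-- A face of the pipe dream complex `PD(w)`: a set of boxes whose complement contains a
reduced word for `w`, i.e. such that some reduced pipe dream of `w` is disjoint from it. -/
def IsPDFace (n : ℕ) (w : Equiv.Perm ℕ) (F : Finset (ℕ × ℕ)) : Prop :=
  F ⊆ boxes n ∧ ∃ P : Finset (ℕ × ℕ), IsReducedPipeDream n w P ∧ Disjoint P F

/-- The vector `e_i - e_j ∈ ℝ^ℕ` attached to the oriented edge `(i,j)`. -/
noncomputable def rvec (p : ℕ × ℕ) : ℕ → ℝ :=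
  Pi.single p.1 1 - Pi.single p.2 1

/-- The root polytope (simplex) of a forest: the convex hull of `0` and the vectors
`e_i - e_j` over its edges. -/
noncomputable def treeSimplex (T : Finset (ℕ × ℕ)) : Set (ℕ → ℝ) :=
  convexHull ℝ ({0} ∪ rvec '' ↑T)

/-- The full root polytope `P(P_n) = ConvHull(0, e_i - e_j : 0 ≤ i < j < n)`. -/
noncomputable def fullRootPolytope (n : ℕ) : Set (ℕ → ℝ) :=
  convexHull ℝ ({0} ∪ {v | ∃ i j, i < j ∧ j < n ∧ v = rvec (i, j)})

/-- The vertex figure `V(P_n)` of `P(P_n)` at the vertex `0`: the intersection of `P(P_n)`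
with a hyperplane strictly separating `0` from all the other vertices `e_i - e_j` (`i < j`);
the linear functional `x ↦ ∑_{i<n} i·x_i` takes value `0` at `0` and value `i - j ≤ -1`
at `e_i - e_j`, so the hyperplane `{∑ i·x_i = -1/2}` is such a hyperplane. -/
noncomputable def vertexFigure (n : ℕ) : Set (ℕ → ℝ) :=
  fullRootPolytope n ∩ {x | ∑ i ∈ Finset.range n, (i : ℝ) * x i = -(1/2 : ℝ)}

/-- The simplex of the canonical triangulation of the vertex figure `V(P_n)` attached to a
forest `F` on `[n]`. -/
noncomputable def vfSimplex (n : ℕ) (F : Finset (ℕ × ℕ)) : Set (ℕ → ℝ) :=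
  treeSimplex F ∩ vertexFigure n

/-! ### Demazure products as comparator networks -/

/-- The comparator at positions `i, i + 1`, sorting the two entries decreasingly. -/
noncomputable def compareAt (i : ℕ) (f : ℕ → ℕ) : ℕ → ℕ := fun p =>
  if p = i then max (f i) (f (i + 1)) else if p = i + 1 then min (f i) (f (i + 1)) else f p

/-- The comparator of the box `(r, c)`, present if the box is a cross. -/
noncomputable def boxAct (S : Finset (ℕ × ℕ)) (r c : ℕ) (f : ℕ → ℕ) : ℕ → ℕ :=
  if (r, c) ∈ S then compareAt (r + c) f else f

/-- The comparators of the columns `m - 1, …, 0` of the row `r`. -/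
noncomputable def rowAct (S : Finset (ℕ × ℕ)) (r : ℕ) : ℕ → (ℕ → ℕ) → (ℕ → ℕ)
  | 0, f => f
  | m + 1, f => rowAct S r m (boxAct S r m f)

/-- The one-line notation obtained from the first `k` rows of the staircase. -/
noncomputable def rowState (n : ℕ) (S : Finset (ℕ × ℕ)) : ℕ → (ℕ → ℕ)
  | 0 => id
  | k + 1 => rowAct S k (n - 1 - k) (rowState n S k)

/-- The number of entries at least `t` among the first `q` entries. -/
noncomputable def largeCount (t : ℕ) (f : ℕ → ℕ) (q : ℕ) : ℕ := Nat.count (fun p => t ≤ f p) q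

lemma compareAt_left (i : ℕ) (f : ℕ → ℕ) : compareAt i f i = max (f i) (f (i + 1)) := by
  simp [compareAt]

lemma compareAt_right (i : ℕ) (f : ℕ → ℕ) : compareAt i f (i + 1) = min (f i) (f (i + 1)) := by
  simp [compareAt]

lemma compareAt_of_ne {i p : ℕ} (f : ℕ → ℕ) (h : p ≠ i) (h' : p ≠ i + 1) :
    compareAt i f p = f p := by
  simp [compareAt, h, h']

lemma permLen_mul_swap {n i : ℕ} (hi : i + 1 < n) (u : Equiv.Perm ℕ) (h : u i < u (i + 1)) :
    permLen n (u * Equiv.swap i (i + 1)) = permLen n u + 1 := by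
  set s := Equiv.swap i (i + 1) with hs
  have hsp : ∀ p, s p = if p = i then i + 1 else if p = i + 1 then i else p := fun p => by
    rw [hs, Equiv.swap_apply_def]
  unfold permLen
  have hnot : (i, i + 1) ∉ ((Finset.range n ×ˢ Finset.range n).filter
      (fun p => p.1 < p.2 ∧ u p.2 < u p.1)).map
        (Equiv.prodCongr s s).toEmbedding := by
    simp only [Finset.mem_map, Finset.mem_filter, Finset.mem_product, Finset.mem_range,
      Equiv.coe_toEmbedding, Equiv.prodCongr_apply, not_exists, not_and, and_imp, Prod.forall,
      Prod.map_apply, Prod.mk.injEq]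
    intro a b _ _ hab _ h1 h2
    have := hsp a
    have := hsp b
    grind
  rw [← Finset.card_map (Equiv.prodCongr s s).toEmbedding
    (s := (Finset.range n ×ˢ Finset.range n).filter (fun p => p.1 < p.2 ∧ u p.2 < u p.1)),
    ← Finset.card_cons hnot]
  congr 1
  ext ⟨a, b⟩
  rw [Finset.mem_filter, Finset.mem_cons, Finset.mem_map_equiv, Finset.mem_filter]
  simp only [Finset.mem_product,
    Finset.mem_range, Equiv.prodCongr_symm, Equiv.prodCongr_apply, Prod.map_apply, Prod.mk.injEq,
    Equiv.Perm.mul_apply]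
  rw [show s.symm = s from Equiv.symm_swap _ _]
  have ha := hsp a
  have hb := hsp b
  by_cases h1 : a = i ∧ b = i + 1
  · obtain ⟨rfl, rfl⟩ := h1
    have e1 : s a = a + 1 := by simp [hsp]
    have e2 : s (a + 1) = a := by simp [hsp]
    rw [e1, e2]
    simp [h, hi, (Nat.lt_succ_self a).trans hi]
  · simp only [h1, false_or]
    by_cases h2 : a = i + 1 ∧ b = i
    · obtain ⟨rfl, rfl⟩ := h2
      have e1 : s b = b + 1 := by simp [hsp]
      have e2 : s (b + 1) = b := by simp [hsp]
      rw [e1, e2]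
      simp [h.le]
    · have : (a < b ↔ s a < s b) := by split_ifs at ha hb <;> omega
      have : (a < n ↔ s a < n) := by split_ifs at ha <;> omega
      have : (b < n ↔ s b < n) := by split_ifs at hb <;> omega
      rw [‹a < b ↔ _›, ‹a < n ↔ _›, ‹b < n ↔ _›]

lemma demazure_step {n i : ℕ} (hi : i + 1 < n) (u : Equiv.Perm ℕ) :
    ⇑(if permLen n u < permLen n (u * Equiv.swap i (i + 1)) then u * Equiv.swap i (i + 1) else u)
      = compareAt i u := by
  have hne : u i ≠ u (i + 1) := fun h => by have := u.injective h; omega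
  funext p
  rcases lt_or_gt_of_ne hne with h | h
  · rw [if_pos (by rw [permLen_mul_swap hi u h]; omega), Equiv.Perm.mul_apply,
      Equiv.swap_apply_def, compareAt, max_eq_right h.le, min_eq_left h.le]
    split_ifs <;> rfl
  · have := permLen_mul_swap hi (u * Equiv.swap i (i + 1)) (by simpa using h)
    rw [mul_assoc, Equiv.swap_mul_self, mul_one] at this
    rw [if_neg (by omega), compareAt, max_eq_left h.le, min_eq_right h.le]
    split_ifs with h1 h2
    · rw [h1]
    · rw [h2]
    · rfl

lemma coe_demazure (n : ℕ) (S : Finset (ℕ × ℕ)) :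
    ⇑(demazure n S) = rowState n S (n - 1) := by
  unfold demazure triWord
  rw [List.foldl_filter, List.foldl_flatMap]
  suffices h : ∀ k ≤ n - 1, ⇑(List.foldl (fun (u : Equiv.Perm ℕ) r => List.foldl
      (fun (u : Equiv.Perm ℕ) b => if decide (b ∈ S) = true then
        (let v := u * Equiv.swap (b.1 + b.2) (b.1 + b.2 + 1)
         if permLen n u < permLen n v then v else u) else u) u
      (((List.range (n - 1 - r)).reverse).map (fun c => (r, c)))) 1 (List.range k))
      = rowState n S k from h _ le_rfl
  intro k hk
  induction k with
  | zero => rfl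
  | succ k ih =>
    rw [List.range_succ, List.foldl_append, List.foldl_cons, List.foldl_nil, rowState,
      ← ih (by omega)]
    generalize List.foldl _ (1 : Equiv.Perm ℕ) (List.range k) = u
    suffices h : ∀ m ≤ n - 1 - k, ∀ u : Equiv.Perm ℕ, ⇑(List.foldl
      (fun (u : Equiv.Perm ℕ) b => if decide (b ∈ S) = true then
        (let v := u * Equiv.swap (b.1 + b.2) (b.1 + b.2 + 1)
         if permLen n u < permLen n v then v else u) else u) u
      (((List.range m).reverse).map (fun c => (k, c)))) = rowAct S k m u from h _ le_rfl u
    intro m hm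
    induction m with
    | zero => intro u; rfl
    | succ m ihm =>
      intro u
      rw [List.range_succ, List.reverse_append, List.reverse_singleton, List.map_append,
        List.map_singleton, List.singleton_append, List.foldl_cons, ihm (by omega), rowAct]
      congr 1
      unfold boxAct
      by_cases h : (k, m) ∈ S
      · rw [if_pos (by simpa using h), if_pos h]
        exact demazure_step (by omega) u
      · rw [if_neg (by simpa using h), if_neg h]

lemma largeCount_succ (t : ℕ) (f : ℕ → ℕ) (q : ℕ) :
    largeCount t f (q + 1) = largeCount t f q + if t ≤ f q then 1 else 0 := by
  simp [largeCount, Nat.count_succ]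

lemma largeCount_mono (t : ℕ) (f : ℕ → ℕ) {p q : ℕ} (h : p ≤ q) :
    largeCount t f p ≤ largeCount t f q := Nat.count_monotone _ h

lemma largeCount_congr {t : ℕ} {f g : ℕ → ℕ} {q : ℕ} (h : ∀ p < q, f p = g p) :
    largeCount t f q = largeCount t g q := by
  induction q with
  | zero => simp [largeCount]
  | succ q ih =>
    rw [largeCount_succ, largeCount_succ, ih (fun p hp => h p (by omega)), h q (by omega)]

lemma largeCount_compareAt_of_ne (t : ℕ) (f : ℕ → ℕ) {i q : ℕ} (h : q ≠ i + 1) :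
    largeCount t (compareAt i f) q = largeCount t f q := by
  rcases Nat.lt_or_gt_of_ne h with h | h
  · exact largeCount_congr fun p hp => compareAt_of_ne _ (by omega) (by omega)
  · obtain ⟨d, rfl⟩ := Nat.exists_eq_add_of_le (Nat.succ_le_of_lt h)
    induction d with
    | zero =>
      simp only [Nat.add_zero, Nat.succ_eq_add_one, largeCount_succ]
      rw [largeCount_congr (g := f) fun p hp => compareAt_of_ne _ (by omega) (by omega),
        compareAt_left, compareAt_right]
      grind
    | succ d ih =>
      rw [← Nat.add_assoc, largeCount_succ, largeCount_succ, ih (by omega) (by omega),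
        compareAt_of_ne _ (by omega) (by omega)]

lemma largeCount_le_compareAt (t : ℕ) (f : ℕ → ℕ) (i q : ℕ) :
    largeCount t f q ≤ largeCount t (compareAt i f) q := by
  by_cases h : q = i + 1
  · subst h
    rw [largeCount_succ, largeCount_succ, largeCount_compareAt_of_ne _ _ (by omega)]
    rw [compareAt_left]
    grind
  · rw [largeCount_compareAt_of_ne _ _ h]

lemma largeCount_compareAt_succ_le (t : ℕ) (f : ℕ → ℕ) (i q : ℕ) :
    largeCount t (compareAt i f) (q + 1) ≤ largeCount t f q + 1 := by
  by_cases h : q = i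
  · subst h
    rw [largeCount_succ, largeCount_compareAt_of_ne _ _ (by omega)]
    split_ifs <;> omega
  · rw [largeCount_compareAt_of_ne _ _ (by omega), largeCount_succ]
    split_ifs <;> omega

lemma largeCount_rowAct_of_ne (t : ℕ) (S : Finset (ℕ × ℕ)) (r m q : ℕ) (f : ℕ → ℕ)
    (h : ∀ c < m, (r, c) ∈ S → q ≠ r + c + 1) :
    largeCount t (rowAct S r m f) q = largeCount t f q := by
  induction m generalizing f with
  | zero => rfl
  | succ m ih =>
    rw [rowAct, ih _ fun c hc => h c (by omega), boxAct]
    split_ifs with hm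
    · exact largeCount_compareAt_of_ne _ _ (h m (by omega) hm)
    · rfl

lemma largeCount_le_rowAct (t : ℕ) (S : Finset (ℕ × ℕ)) (r m q : ℕ) (f : ℕ → ℕ) :
    largeCount t f q ≤ largeCount t (rowAct S r m f) q := by
  induction m generalizing f with
  | zero => rfl
  | succ m ih =>
    rw [rowAct]
    refine le_trans ?_ (ih _)
    rw [boxAct]
    split_ifs
    · exact largeCount_le_compareAt _ _ _ _
    · rfl

lemma largeCount_rowAct_succ_le (t : ℕ) (S : Finset (ℕ × ℕ)) (r m q : ℕ) (f : ℕ → ℕ) :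
    largeCount t (rowAct S r m f) (q + 1) ≤ largeCount t f q + 1 := by
  have hs : largeCount t f (q + 1) ≤ largeCount t f q + 1 := by
    rw [largeCount_succ]; split_ifs <;> omega
  induction m generalizing f with
  | zero => exact hs
  | succ m ih =>
    rcases lt_trichotomy q (r + m) with h | h | h
    · rw [rowAct]
      have e : largeCount t (boxAct S r m f) q = largeCount t f q := by
        rw [boxAct]
        split_ifs
        · exact largeCount_compareAt_of_ne _ _ (by omega)
        · rfl
      rw [← e]
      refine ih _ ?_
      rw [largeCount_succ]; split_ifs <;> omega
    · rw [rowAct, largeCount_rowAct_of_ne _ _ _ _ _ _ fun c hc _ => by omega, boxAct]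
      split_ifs
      · exact largeCount_compareAt_succ_le _ _ _ _
      · exact hs
    · rwa [largeCount_rowAct_of_ne _ _ _ _ _ _ fun c hc _ => by omega]

lemma rowAct_apply_of_not_mem (S : Finset (ℕ × ℕ)) (r m p : ℕ) (f : ℕ → ℕ)
    (h : ∀ c < m, (r, c) ∈ S → p ≠ r + c ∧ p ≠ r + c + 1) : rowAct S r m f p = f p := by
  induction m generalizing f with
  | zero => rfl
  | succ m ih =>
    rw [rowAct, ih _ fun c hc => h c (by omega), boxAct]
    split_ifs with hm
    · exact compareAt_of_ne _ (h m (by omega) hm).1 (h m (by omega) hm).2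
    · rfl

/-- If the comparator of the box `(r, c)` is present and a large entry sits at position
`r + c + 1` after the row `r`, then that entry was blocked by the large entry at `r + c`. -/
lemma rowAct_blocked {t : ℕ} {S : Finset (ℕ × ℕ)} {r c m : ℕ} {f : ℕ → ℕ} (hc : c < m)
    (hS : (r, c) ∈ S) (h : t ≤ rowAct S r m f (r + c + 1)) :
    t ≤ f (r + c) ∧ largeCount t (rowAct S r m f) (r + c + 1) = largeCount t f (r + c) + 1 := by
  induction m generalizing f with
  | zero => omega
  | succ m ih =>
    rw [rowAct] at h ⊢
    rcases Nat.lt_or_ge c m with hcm | hcm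
    · have := ih hcm h
      have e : ∀ p ≤ r + c, boxAct S r m f p = f p := fun p hp => by
        rw [boxAct]
        split_ifs
        · exact compareAt_of_ne _ (by omega) (by omega)
        · rfl
      rwa [e _ le_rfl, largeCount_congr (g := f) fun p hp => e p (by omega)] at this
    · obtain rfl : c = m := by omega
      rw [rowAct_apply_of_not_mem _ _ _ _ _ fun d hd _ => by omega, boxAct, if_pos hS,
        compareAt_right] at h
      rw [largeCount_rowAct_of_ne _ _ _ _ _ _ fun d hd _ => by omega, boxAct, if_pos hS,
        largeCount_succ, largeCount_compareAt_of_ne _ _ (by omega),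
        compareAt_left]
      have := (le_min_iff.1 h)
      refine ⟨this.1, ?_⟩
      rw [if_pos (le_max_of_le_left this.1)]

/-- Two elbows `(r, c)`, `(r', c')` in conflict: the corresponding edges cross or form an
increasing path. -/
def Conflict (n : ℕ) (b b' : ℕ × ℕ) : Prop := b.2 < b'.2 ∧ b'.1 < b.1 ∧ b.1 + b'.2 + 1 ≤ n

lemma largeCount_rowState_of_le (t n : ℕ) (S : Finset (ℕ × ℕ)) {q k l : ℕ} (hq : q ≤ k)
    (hkl : k ≤ l) : largeCount t (rowState n S l) q = largeCount t (rowState n S k) q := by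
  induction l, hkl using Nat.le_induction with
  | base => rfl
  | succ l hl ih => rw [rowState, largeCount_rowAct_of_ne _ _ _ _ _ _ fun c _ _ => by omega, ih]

lemma largeCount_id (t q : ℕ) : largeCount t id q = q - t := by
  induction q with
  | zero => simp [largeCount]
  | succ q ih => rw [largeCount_succ, ih]; simp only [id]; split_ifs <;> omega

lemma piPerm_apply (n i : ℕ) : piPerm n i = if 1 ≤ i ∧ i < n then n - i else i := rfl

lemma largeCount_piPerm {n t q : ℕ} (ht : 1 ≤ t) (hq : q + t ≤ n) :
    largeCount t (piPerm n) (q + 1) = q := by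
  induction q with
  | zero => rw [largeCount_succ, piPerm_apply]; simp [largeCount]; omega
  | succ q ih =>
    have h : piPerm n (q + 1) = n - (q + 1) := by rw [piPerm_apply, if_pos (by omega)]
    rw [largeCount_succ, ih (by omega), h, if_pos (by omega)]

/-- The complement of a pipe dream of `1 n (n-1) ⋯ 2` contains no conflicting pair. -/
lemma not_conflict_of_demazure {n : ℕ} {S : Finset (ℕ × ℕ)} (h : demazure n S = piPerm n)
    {b b' : ℕ × ℕ} (hb : b ∉ S) (hb' : b' ∉ S) : ¬ Conflict n b b' := by
  obtain ⟨r, c⟩ := b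
  obtain ⟨r', c'⟩ := b'
  rintro ⟨hc, hr, hn⟩
  simp only at hc hr hn
  set t := c' + 1 with ht
  have h1 : ∀ k ≤ r', largeCount t (rowState n S k) (t + k) ≤ k := by
    intro k hk
    induction k with
    | zero => simp [rowState, largeCount_id]
    | succ k ih =>
      exact (largeCount_rowAct_succ_le _ _ _ _ _ _).trans (Nat.succ_le_succ (ih (by omega)))
  have h2 : ∀ k ≥ r', largeCount t (rowState n S (k + 1)) (t + k) ≤ k := by
    intro k hk
    induction k, hk using Nat.le_induction with
    | base =>
      rw [rowState, largeCount_rowAct_of_ne]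
      · exact h1 _ le_rfl
      · rintro d hd hd' he
        obtain rfl : d = c' := by omega
        exact hb' hd'
    | succ k hk ih =>
      exact (largeCount_rowAct_succ_le _ _ _ _ _ _).trans (Nat.succ_le_succ ih)
  obtain ⟨k, rfl⟩ : ∃ k, r = k + 1 := ⟨r - 1, by omega⟩
  have h3 : largeCount t (rowState n S (k + 1 + 1)) (k + 1 + c + 1) ≤ k := by
    rw [rowState, largeCount_rowAct_of_ne]
    · exact (largeCount_mono _ _ (by omega)).trans (h2 k (by omega))
    · rintro d hd hd' he
      obtain rfl : d = c := by omega
      exact hb hd'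
  have h4 : largeCount t (rowState n S (n - 1)) (k + 2) ≤ k := by
    rcases Nat.lt_or_ge (n - 1) (k + 1 + 1) with hk | hk
    · omega
    · rw [largeCount_rowState_of_le _ _ _ (le_refl (k + 2)) hk]
      exact (largeCount_mono _ _ (by omega)).trans h3
  rw [← coe_demazure, h, largeCount_piPerm (by omega) (by omega)] at h4
  omega

lemma exists_elbow_of_large {n t : ℕ} {S : Finset (ℕ × ℕ)} {k q : ℕ} (hkq : k < q) (hq : q < n)
    (ho : t ≤ rowState n S (k + 1) q) (hM : largeCount t (rowState n S (k + 1)) q = k) :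
    ∃ r ≤ k, (r, q - 1 - k) ∉ S := by
  induction k generalizing q with
  | zero =>
    refine ⟨0, le_rfl, fun hS => ?_⟩
    have := rowAct_blocked (t := t) (m := n - 1 - 0) (f := rowState n S 0) (by omega) hS
      (by rwa [show 0 + (q - 1 - 0) + 1 = q by omega])
    rw [show 0 + (q - 1 - 0) + 1 = q by omega] at this
    rw [rowState] at hM
    omega
  | succ k ih =>
    by_cases hS : (k + 1, q - 1 - (k + 1)) ∈ S
    · have := rowAct_blocked (t := t) (m := n - 1 - (k + 1)) (f := rowState n S (k + 1))
        (by omega) hS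
        (by rwa [show k + 1 + (q - 1 - (k + 1)) + 1 = q by omega])
      rw [show k + 1 + (q - 1 - (k + 1)) + 1 = q by omega,
        show k + 1 + (q - 1 - (k + 1)) = q - 1 by omega] at this
      rw [rowState] at hM
      obtain ⟨r, hr, hr'⟩ := ih (q := q - 1) (by omega) (by omega) this.1 (by omega)
      exact ⟨r, by omega, by rwa [show q - 1 - (k + 1) = q - 1 - 1 - k by omega]⟩
    · exact ⟨k + 1, le_rfl, hS⟩

lemma exists_large_of_largeCount_lt {t : ℕ} {f : ℕ → ℕ} {p n : ℕ} (hpn : p ≤ n)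
    (h : largeCount t f p < largeCount t f n) :
    ∃ q, p ≤ q ∧ q < n ∧ t ≤ f q ∧ largeCount t f q = largeCount t f p := by
  induction n, hpn using Nat.le_induction with
  | base => omega
  | succ n hn ih =>
    by_cases h' : largeCount t f p < largeCount t f n
    · obtain ⟨q, h1, h2, h3⟩ := ih h'
      exact ⟨q, h1, by omega, h3⟩
    · have := largeCount_mono t f hn
      rw [largeCount_succ] at h
      refine ⟨n, hn, by omega, ?_, by omega⟩
      by_contra h0
      rw [if_neg h0] at h
      omega

lemma largeCount_rowState_total (t : ℕ) {n : ℕ} (S : Finset (ℕ × ℕ)) (k : ℕ) :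
    largeCount t (rowState n S k) n = n - t := by
  induction k with
  | zero => exact largeCount_id _ _
  | succ k ih => rw [rowState, largeCount_rowAct_of_ne _ _ _ _ _ _ fun c hc _ => by omega, ih]

/-- A set of crosses whose complement contains no conflicting pair pushes, for every threshold,
the large entries as far to the left as possible. -/
lemma le_largeCount_rowState {n t : ℕ} {S : Finset (ℕ × ℕ)}
    (hS : ∀ b ∈ boxes n, ∀ b' ∈ boxes n, b ∉ S → b' ∉ S → ¬ Conflict n b b')
    {k : ℕ} (hk : k + t ≤ n) (ht : 1 ≤ t) :
    k ≤ largeCount t (rowState n S (k + 1)) (k + 1) := by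
  induction k with
  | zero => omega
  | succ k ih =>
    have ih := ih (by omega)
    by_contra! hlt
    change largeCount t (rowState n S (k + 2)) (k + 2) < k + 1 at hlt
    have htot := largeCount_rowState_total t (n := n) S
    have h1 : largeCount t (rowState n S (k + 2)) (k + 1) = k := by
      have := largeCount_mono t (rowState n S (k + 2)) (show k + 1 ≤ k + 2 by omega)
      have := largeCount_rowState_of_le t n S (le_refl (k + 1)) (show k + 1 ≤ k + 2 by omega)
      omega
    have h2 : largeCount t (rowState n S (k + 2)) (k + 2) = k := by
      have := largeCount_mono t (rowState n S (k + 2)) (show k + 1 ≤ k + 2 by omega)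
      omega
    have h0 := largeCount_rowState_of_le t n S (le_refl (k + 1)) (show k + 1 ≤ k + 2 by omega)
    obtain ⟨p, hp, hpn, hpo, hpM⟩ := exists_large_of_largeCount_lt (t := t)
      (f := rowState n S (k + 2)) (p := k + 2) (n := n) (by omega) (by rw [htot]; omega)
    have hb : (k + 1, p - (k + 2)) ∉ S := by
      intro hS
      have := rowAct_blocked (t := t) (m := n - 1 - (k + 1)) (f := rowState n S (k + 1))
        (by omega) hS
        (by rwa [show k + 1 + (p - (k + 2)) + 1 = p by omega])
      rw [show k + 1 + (p - (k + 2)) + 1 = p by omega,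
        show k + 1 + (p - (k + 2)) = p - 1 by omega] at this
      have h4 : largeCount t (rowState n S (k + 2)) p = _ := this.2
      have := largeCount_mono t (rowState n S (k + 1)) (show k + 1 ≤ p - 1 by omega)
      omega
    have h3 : largeCount t (rowState n S (k + 1)) p = k := by
      have e1 : _ ≤ largeCount t (rowState n S (k + 2)) p :=
        largeCount_le_rowAct t S (k + 1) (n - 1 - (k + 1)) p (rowState n S (k + 1))
      have e2 := largeCount_mono t (rowState n S (k + 1)) (show k + 1 ≤ p by omega)
      omega
    obtain ⟨q, hq, hqn, hqo, hqM⟩ := exists_large_of_largeCount_lt (t := t)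
      (f := rowState n S (k + 1)) (p := p) (n := n) (by omega) (by rw [htot]; omega)
    obtain ⟨r, hr, hr'⟩ := exists_elbow_of_large (by omega) hqn hqo (hqM.trans h3)
    refine hS _ ?_ _ ?_ hb hr' ⟨?_, ?_, ?_⟩
    · simp [boxes]; omega
    · simp [boxes]; omega
    all_goals simp only
    all_goals omega

lemma rowState_apply_zero {n : ℕ} {S : Finset (ℕ × ℕ)} (h0 : (0, 0) ∉ S) (k : ℕ) :
    rowState n S k 0 = 0 := by
  induction k with
  | zero => rfl
  | succ k ih =>
    rw [rowState, rowAct_apply_of_not_mem, ih]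
    rintro c - hc
    refine ⟨fun h => ?_, by omega⟩
    obtain ⟨rfl, rfl⟩ : k = 0 ∧ c = 0 := by omega
    exact h0 hc

lemma rowState_apply_of_le {n : ℕ} {S : Finset (ℕ × ℕ)} (k : ℕ) {p : ℕ} (hp : n ≤ p) :
    rowState n S k p = p := by
  induction k with
  | zero => rfl
  | succ k ih => rw [rowState, rowAct_apply_of_not_mem _ _ _ _ _ fun c hc _ => by omega, ih]

lemma demazure_eq_piPerm {n : ℕ} {S : Finset (ℕ × ℕ)} (h0 : (0, 0) ∉ S)
    (hS : ∀ b ∈ boxes n, ∀ b' ∈ boxes n, b ∉ S → b' ∉ S → ¬ Conflict n b b') :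
    demazure n S = piPerm n := by
  have hz : demazure n S 0 = 0 := by rw [coe_demazure]; exact rowState_apply_zero h0 _
  have hle : ∀ p ≥ n, demazure n S p = p := fun p hp => by
    rw [coe_demazure]; exact rowState_apply_of_le _ hp
  have hcount : ∀ t k, 1 ≤ t → k + t ≤ n → k ≤ largeCount t (demazure n S) (k + 1) := by
    intro t k ht hk
    rw [coe_demazure]
    rcases Nat.lt_or_ge (n - 1) (k + 1) with hkn | hkn
    · obtain rfl : k + 1 = n := by omega
      rw [largeCount_rowState_total]; omega
    · rw [largeCount_rowState_of_le _ _ _ le_rfl hkn]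
      exact le_largeCount_rowState hS hk ht
  have hge : ∀ j, 1 ≤ j → j < n → n - j ≤ demazure n S j := by
    intro j hj hjn
    by_contra! hlt
    have h1 := hcount (n - j) j (by omega) (by omega)
    rw [largeCount_succ, if_neg (by omega)] at h1
    have h2 : ∀ q, largeCount (n - j) (demazure n S) (q + 1) ≤ q := by
      intro q
      induction q with
      | zero => rw [largeCount_succ, hz, if_neg (by omega)]; simp [largeCount]
      | succ q ih => rw [largeCount_succ]; split_ifs <;> omega
    have := h2 (j - 1)
    rw [show j - 1 + 1 = j by omega] at this
    omega
  have heq : ∀ j, 1 ≤ j → j < n → demazure n S j = n - j := by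
    intro j
    induction j using Nat.strong_induction_on with
    | _ j ih =>
      intro hj hjn
      have h1 := hge j hj hjn
      by_contra hne
      by_cases hbig : n ≤ demazure n S j
      · have := (demazure n S).injective (hle _ hbig)
        omega
      · have h2 := ih (n - demazure n S j) (by omega) (by omega) (by omega)
        have := (demazure n S).injective (h2.trans (Nat.sub_sub_self (by omega)))
        omega
  ext p
  rw [piPerm_apply]
  split_ifs with hp
  · exact heq p hp.1 hp.2
  · rcases Nat.eq_zero_or_pos p with rfl | hp0
    · exact hz
    · exact hle p (by omega)

/-! ### Noncrossing alternating trees -/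

lemma graphOf_adj {E : Finset (ℕ × ℕ)} (hE : ∀ p ∈ E, p.1 < p.2) {x y : ℕ} :
    (graphOf E).Adj x y ↔ (x, y) ∈ E ∨ (y, x) ∈ E := by
  simp only [graphOf, SimpleGraph.fromEdgeSet_adj, Finset.coe_image, Set.mem_image,
    Finset.mem_coe, Prod.exists, Sym2.eq_iff]
  constructor
  · rintro ⟨⟨a, b, h, ⟨rfl, rfl⟩ | ⟨rfl, rfl⟩⟩, -⟩
    · exact Or.inl h
    · exact Or.inr h
  · rintro (h | h)
    · exact ⟨⟨x, y, h, Or.inl ⟨rfl, rfl⟩⟩, (hE _ h).ne⟩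
    · exact ⟨⟨y, x, h, Or.inr ⟨rfl, rfl⟩⟩, (hE _ h).ne'⟩

lemma graphOf_mono {E F : Finset (ℕ × ℕ)} (h : E ⊆ F) : graphOf E ≤ graphOf F :=
  SimpleGraph.fromEdgeSet_mono (Finset.coe_subset.2 (Finset.image_subset_image h))

/-- A noncrossing alternating tree on the interval `[a, b]`; acyclicity is witnessed by a
vertex set `A` cut by each edge and by no other edge. -/
structure IsIntervalTree (a b : ℕ) (T : Finset (ℕ × ℕ)) : Prop where
  lt : ∀ p ∈ T, p.1 < p.2
  bounds : ∀ p ∈ T, a ≤ p.1 ∧ p.2 ≤ b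
  noncrossing : Noncrossing T
  alternating : Alternating T
  card : T.card = b - a
  cut : ∀ e ∈ T, ∃ A : ℕ → Prop, A e.1 ∧ ¬ A e.2 ∧ ∀ p ∈ T, p ≠ e → (A p.1 ↔ A p.2)
  reachable : ∀ x, a ≤ x → x ≤ b → (graphOf T).Reachable a x
  root : a < b → (a, b) ∈ T

lemma isIntervalTree_self (a : ℕ) : IsIntervalTree a a ∅ where
  lt := by simp
  bounds := by simp
  noncrossing := by simp [Noncrossing]
  alternating := by simp [Alternating]
  card := by simp
  cut := by simp
  reachable x h h' := by rw [le_antisymm h h']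
  root h := absurd h (lt_irrefl _)

lemma IsIntervalTree.join {a k b : ℕ} {T₁ T₂ : Finset (ℕ × ℕ)} (h₁ : IsIntervalTree a k T₁)
    (h₂ : IsIntervalTree (k + 1) b T₂) (hak : a ≤ k) (hkb : k < b) :
    IsIntervalTree a b (insert (a, b) (T₁ ∪ T₂)) where
  lt := by
    intro p hp
    simp only [Finset.mem_insert, Finset.mem_union] at hp
    rcases hp with rfl | hp | hp
    · simp only; omega
    · exact h₁.lt p hp
    · exact h₂.lt p hp
  bounds := by
    intro p hp
    simp only [Finset.mem_insert, Finset.mem_union] at hp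
    rcases hp with rfl | hp | hp
    · simp
    · have := h₁.bounds p hp; omega
    · have := h₂.bounds p hp; omega
  noncrossing := by
    rintro ⟨i, j, l, m, hij, hjl, hlm, h, h'⟩
    simp only [Finset.mem_insert, Finset.mem_union, Prod.mk.injEq] at h h'
    rcases h with h | h | h <;> rcases h' with h' | h' | h'
    · omega
    · have := h₁.bounds _ h'; simp only at this; omega
    · have := h₂.bounds _ h'; simp only at this; omega
    · have := h₁.bounds _ h; simp only at this; omega
    · exact h₁.noncrossing ⟨i, j, l, m, hij, hjl, hlm, h, h'⟩
    · have := h₁.bounds _ h; have := h₂.bounds _ h'; simp only at *; omega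
    · have := h₂.bounds _ h; simp only at this; omega
    · have := h₂.bounds _ h; have := h₁.bounds _ h'; simp only at *; omega
    · exact h₂.noncrossing ⟨i, j, l, m, hij, hjl, hlm, h, h'⟩
  alternating := by
    rintro ⟨i, j, l, hij, hjl, h, h'⟩
    simp only [Finset.mem_insert, Finset.mem_union, Prod.mk.injEq] at h h'
    rcases h with h | h | h <;> rcases h' with h' | h' | h'
    · omega
    · have := h₁.bounds _ h'; simp only at this; omega
    · have := h₂.bounds _ h'; simp only at this; omega
    · have := h₁.bounds _ h; simp only at this; omega
    · exact h₁.alternating ⟨i, j, l, hij, hjl, h, h'⟩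
    · have := h₁.bounds _ h; have := h₂.bounds _ h'; simp only at *; omega
    · have := h₂.bounds _ h; simp only at this; omega
    · have := h₂.bounds _ h; have := h₁.bounds _ h'; simp only at *; omega
    · exact h₂.alternating ⟨i, j, l, hij, hjl, h, h'⟩
  card := by
    have hd : Disjoint T₁ T₂ := Finset.disjoint_left.2 fun p hp hp' => by
      have := h₁.bounds p hp; have := h₂.bounds p hp'; have := h₁.lt p hp; omega
    have hn : (a, b) ∉ T₁ ∪ T₂ := by
      rw [Finset.mem_union]
      rintro (h | h)
      · have := h₁.bounds _ h; simp only at this; omega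
      · have := h₂.bounds _ h; simp only at this; omega
    rw [Finset.card_insert_of_notMem hn, Finset.card_union_of_disjoint hd, h₁.card, h₂.card]
    omega
  cut := by
    intro e he
    simp only [Finset.mem_insert, Finset.mem_union] at he
    rcases he with rfl | he | he
    · refine ⟨fun x => x ≤ k, hak, by simp only; omega, fun p hp hne => ?_⟩
      simp only [Finset.mem_insert, Finset.mem_union, hne, false_or] at hp
      rcases hp with hp | hp
      · have := h₁.bounds p hp; have := h₁.lt p hp; constructor <;> intro <;> omega
      · have := h₂.bounds p hp; have := h₂.lt p hp; constructor <;> intro <;> omega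
    · obtain ⟨A, hA, hA', hAT⟩ := h₁.cut e he
      have := h₁.bounds e he
      have := h₁.lt e he
      refine ⟨fun x => if x ≤ k then A x else A a, by beta_reduce; rwa [if_pos (by omega)],
        by beta_reduce; rwa [if_pos (by omega)], fun p hp hne => ?_⟩
      simp only [Finset.mem_insert, Finset.mem_union] at hp
      rcases hp with rfl | hp | hp
      · beta_reduce
        rw [if_pos hak, if_neg (by simp only; omega)]
      · have := h₁.bounds p hp
        have := h₁.lt p hp
        beta_reduce
        rw [if_pos (by omega), if_pos (by omega)]
        exact hAT p hp hne
      · have := h₂.bounds p hp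
        have := h₂.lt p hp
        beta_reduce
        rw [if_neg (by omega), if_neg (by omega)]
    · obtain ⟨A, hA, hA', hAT⟩ := h₂.cut e he
      have := h₂.bounds e he
      have := h₂.lt e he
      refine ⟨fun x => if x ≤ k then A b else A x, by beta_reduce; rwa [if_neg (by omega)],
        by beta_reduce; rwa [if_neg (by omega)], fun p hp hne => ?_⟩
      simp only [Finset.mem_insert, Finset.mem_union] at hp
      rcases hp with rfl | hp | hp
      · beta_reduce
        rw [if_pos hak, if_neg (by simp only; omega)]
      · have := h₁.bounds p hp
        have := h₁.lt p hp
        beta_reduce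
        rw [if_pos (by omega), if_pos (by omega)]
      · have := h₂.bounds p hp
        have := h₂.lt p hp
        beta_reduce
        rw [if_neg (by omega), if_neg (by omega)]
        exact hAT p hp hne
  reachable := by
    set T := insert (a, b) (T₁ ∪ T₂) with hT
    have hs₁ : T₁ ⊆ T := fun p hp => by simp [hT, hp]
    have hs₂ : T₂ ⊆ T := fun p hp => by simp [hT, hp]
    have hab : (graphOf T).Adj a b := by
      simp only [graphOf, SimpleGraph.fromEdgeSet_adj, Finset.coe_image]
      exact ⟨⟨(a, b), by simp [hT], rfl⟩, by omega⟩
    intro x hax hxb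
    rcases Nat.lt_or_ge k x with hx | hx
    · exact hab.reachable.trans (((h₂.reachable b hkb le_rfl).symm.trans
        (h₂.reachable x hx hxb)).mono (graphOf_mono hs₂))
    · exact (h₁.reachable x hax hx).mono (graphOf_mono hs₁)
  root _ := Finset.mem_insert_self _ _

lemma Noncrossing.mono {E F : Finset (ℕ × ℕ)} (hF : Noncrossing F) (h : E ⊆ F) :
    Noncrossing E := by
  rintro ⟨i, j, k, l, h1, h2, h3, h4, h5⟩
  exact hF ⟨i, j, k, l, h1, h2, h3, h h4, h h5⟩

lemma Alternating.mono {E F : Finset (ℕ × ℕ)} (hF : Alternating F) (h : E ⊆ F) :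
    Alternating E := by
  rintro ⟨i, j, k, h1, h2, h4, h5⟩
  exact hF ⟨i, j, k, h1, h2, h h4, h h5⟩

/-- Every noncrossing alternating graph on an interval extends to a noncrossing alternating
tree on that interval. -/
lemma exists_isIntervalTree {a b : ℕ} (hab : a ≤ b) {F : Finset (ℕ × ℕ)}
    (hlt : ∀ p ∈ F, p.1 < p.2) (hF : ∀ p ∈ F, a ≤ p.1 ∧ p.2 ≤ b) (hnc : Noncrossing F)
    (halt : Alternating F) : ∃ T, IsIntervalTree a b T ∧ F ⊆ T := by
  induction hd : b - a using Nat.strong_induction_on generalizing a b F with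
  | _ d ih =>
    subst hd
    rcases hab.eq_or_lt with rfl | hab
    · refine ⟨∅, isIntervalTree_self a, fun p hp => ?_⟩
      have := hlt p hp; have := hF p hp; omega
    obtain ⟨k, hak, hkb, hk, hmax⟩ : ∃ k, a ≤ k ∧ k < b ∧ (k = a ∨ (a, k) ∈ F) ∧
        ∀ j, (a, j) ∈ F → j < b → j ≤ k := by
      have hne : ((Finset.Ico a b).filter (fun k => k = a ∨ (a, k) ∈ F)).Nonempty :=
        ⟨a, by simp [hab]⟩
      have hmem := Finset.max'_mem _ hne
      simp only [Finset.mem_filter, Finset.mem_Ico] at hmem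
      refine ⟨_, hmem.1.1, hmem.1.2, hmem.2, fun j hj hjb => Finset.le_max' _ _ ?_⟩
      simp only [Finset.mem_filter, Finset.mem_Ico]
      exact ⟨⟨(hlt _ hj).le, hjb⟩, Or.inr hj⟩
    obtain ⟨T₁, hT₁, hF₁⟩ := ih (k - a) (by omega) hak (F := F.filter (fun p => p.2 ≤ k))
      (fun p hp => hlt p (Finset.mem_of_mem_filter p hp))
      (fun p hp => ⟨(hF p (Finset.mem_of_mem_filter p hp)).1, (Finset.mem_filter.1 hp).2⟩)
      (hnc.mono (Finset.filter_subset _ _)) (halt.mono (Finset.filter_subset _ _)) rfl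
    obtain ⟨T₂, hT₂, hF₂⟩ := ih (b - (k + 1)) (by omega) hkb (F := F.filter (fun p => k < p.1))
      (fun p hp => hlt p (Finset.mem_of_mem_filter p hp))
      (fun p hp => ⟨(Finset.mem_filter.1 hp).2, (hF p (Finset.mem_of_mem_filter p hp)).2⟩)
      (hnc.mono (Finset.filter_subset _ _)) (halt.mono (Finset.filter_subset _ _)) rfl
    refine ⟨_, hT₁.join hT₂ hak hkb, ?_⟩
    rintro ⟨i, j⟩ hp
    have hij : i < j := hlt _ hp
    have hb : a ≤ i ∧ j ≤ b := hF _ hp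
    simp only [Finset.mem_insert, Finset.mem_union, Prod.mk.injEq]
    by_cases hjk : j ≤ k
    · exact Or.inr (Or.inl (hF₁ (Finset.mem_filter.2 ⟨hp, hjk⟩)))
    by_cases hik : k < i
    · exact Or.inr (Or.inr (hF₂ (Finset.mem_filter.2 ⟨hp, hik⟩)))
    left
    have hia : i = a := by
      by_contra hia
      rcases hk with rfl | hk
      · omega
      rcases (not_lt.1 hik).eq_or_lt with rfl | hik
      · exact halt ⟨a, i, j, by omega, hij, hk, hp⟩
      · exact hnc ⟨a, i, k, j, by omega, hik, by omega, hk, hp⟩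
    subst hia
    refine ⟨rfl, ?_⟩
    by_contra hjb
    exact hjk (hmax j hp (by omega))

lemma IsIntervalTree.isSpanningTree {n : ℕ} (hn : 1 ≤ n) {T : Finset (ℕ × ℕ)}
    (hT : IsIntervalTree 0 (n - 1) T) : IsSpanningTree n T := by
  refine ⟨fun p hp => ⟨hT.lt p hp, by have := hT.bounds p hp; omega⟩, ?_, fun x y hx hy =>
    (hT.reachable x (Nat.zero_le _) (by omega)).symm.trans
      (hT.reachable y (Nat.zero_le _) (by omega))⟩
  have key : ∀ e ∈ T, ¬ ((graphOf T).deleteEdges {s(e.1, e.2)}).Reachable e.1 e.2 := by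
    rintro e he ⟨w⟩
    obtain ⟨A, hA, hA', hAT⟩ := hT.cut e he
    have hw : ∀ x y, ((graphOf T).deleteEdges {s(e.1, e.2)}).Walk x y → (A x ↔ A y) := by
      intro x y w
      induction w with
      | nil => rfl
      | cons h _ ih =>
        rw [← ih]
        simp only [SimpleGraph.deleteEdges_adj, Set.mem_singleton_iff, graphOf_adj hT.lt] at h
        rcases h with ⟨h | h, hne⟩
        · exact hAT _ h fun he => hne (by rw [← he])
        · exact (hAT _ h fun he => hne (by rw [← he, Sym2.eq_swap])).symm
    exact hA' ((hw _ _ w).1 hA)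
  rw [SimpleGraph.isAcyclic_iff_forall_adj_isBridge]
  intro x y hxy
  rw [graphOf_adj hT.lt] at hxy
  rcases hxy with h | h
  · exact SimpleGraph.isBridge_iff.2 (key _ h)
  · rw [Sym2.eq_swap]
    exact SimpleGraph.isBridge_iff.2 (key _ h)

lemma IsSpanningTree.eq_of_subset {n : ℕ} {T T' : Finset (ℕ × ℕ)} (hT : IsSpanningTree n T)
    (hT' : IsSpanningTree n T') (h : T ⊆ T') : T = T' := by
  refine h.antisymm fun e he => ?_
  by_contra heT
  have hlt := hT'.1 e he
  have hadj : (graphOf T').Adj e.1 e.2 := (graphOf_adj fun p hp => (hT'.1 p hp).1).2 (Or.inl he)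
  refine SimpleGraph.isBridge_iff.1
    (SimpleGraph.isAcyclic_iff_forall_adj_isBridge.1 hT'.2.1 hadj)
    ((hT.2.2 e.1 e.2 (by omega) hlt.2).mono ?_)
  intro x y hxy
  rw [SimpleGraph.deleteEdges_adj]
  refine ⟨graphOf_mono h hxy, fun hs => heT ?_⟩
  rw [graphOf_adj fun p hp => (hT.1 p hp).1] at hxy
  rw [Set.mem_singleton_iff, Sym2.eq_iff] at hs
  rcases hs with ⟨rfl, rfl⟩ | ⟨rfl, rfl⟩ <;> rcases hxy with hxy | hxy
  · exact hxy
  · have := (hT.1 _ hxy).1; simp only at this; omega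
  · have := (hT.1 _ hxy).1; simp only at this; omega
  · exact hxy

/-- The noncrossing alternating spanning trees of `K_n`. -/
def IsNATree (n : ℕ) (T : Finset (ℕ × ℕ)) : Prop :=
  IsSpanningTree n T ∧ Noncrossing T ∧ Alternating T

lemma exists_isNATree {n : ℕ} (hn : 1 ≤ n) {F : Finset (ℕ × ℕ)}
    (hF : ∀ p ∈ F, p.1 < p.2 ∧ p.2 < n) (hnc : Noncrossing F) (halt : Alternating F) :
    ∃ T, IsNATree n T ∧ F ⊆ T ∧ T.card = n - 1 ∧ (2 ≤ n → (0, n - 1) ∈ T) := by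
  obtain ⟨T, hT, hFT⟩ := exists_isIntervalTree (Nat.zero_le (n - 1)) (fun p hp => (hF p hp).1)
    (fun p hp => ⟨Nat.zero_le _, by have := (hF p hp).2; omega⟩) hnc halt
  exact ⟨T, ⟨hT.isSpanningTree hn, hT.noncrossing, hT.alternating⟩, hFT, hT.card,
    fun h => hT.root (by omega)⟩

lemma IsNATree.card_and_root {n : ℕ} (hn : 1 ≤ n) {T : Finset (ℕ × ℕ)} (hT : IsNATree n T) :
    T.card = n - 1 ∧ (2 ≤ n → (0, n - 1) ∈ T) := by
  obtain ⟨T', hT', hs, h⟩ := exists_isNATree hn hT.1.1 hT.2.1 hT.2.2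
  rwa [hT.1.eq_of_subset hT'.1 hs]

/-! ### Boxes and edges -/

lemma mem_boxes {n : ℕ} {b : ℕ × ℕ} : b ∈ boxes n ↔ b.1 + b.2 + 2 ≤ n := by
  simp only [boxes, Finset.mem_filter, Finset.mem_product, Finset.mem_range]
  omega

/-- The edges `(i, j)`, `i < j`, of the complete graph `K_n`. -/
def completeEdges (n : ℕ) : Finset (ℕ × ℕ) :=
  (Finset.range n ×ˢ Finset.range n).filter (fun p => p.1 < p.2)

lemma mem_completeEdges {n : ℕ} {p : ℕ × ℕ} : p ∈ completeEdges n ↔ p.1 < p.2 ∧ p.2 < n := by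
  simp only [completeEdges, Finset.mem_filter, Finset.mem_product, Finset.mem_range]
  omega

lemma boxEdge_injOn (n : ℕ) : Set.InjOn (boxEdge n) (boxes n) := by
  rintro ⟨r, c⟩ h ⟨r', c'⟩ h' heq
  simp only [Finset.mem_coe, mem_boxes, boxEdge, Prod.mk.injEq] at *
  omega

lemma image_boxes (n : ℕ) : (boxes n).image (boxEdge n) = completeEdges n := by
  ext ⟨i, j⟩
  simp only [Finset.mem_image, mem_boxes, mem_completeEdges, boxEdge, Prod.exists, Prod.mk.injEq]
  constructor
  · rintro ⟨r, c, h, rfl, rfl⟩; omega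
  · rintro h; exact ⟨n - 1 - j, i, by omega, rfl, by omega⟩

lemma card_completeEdges (n : ℕ) : (completeEdges n).card = permLen n (piPerm n) + (n - 1) := by
  rw [← Finset.card_filter_add_card_filter_not (s := completeEdges n) (fun p => 1 ≤ p.1)]
  congr 1
  · unfold permLen completeEdges
    rw [Finset.filter_filter]
    congr 1
    refine Finset.filter_congr ?_
    rintro ⟨i, j⟩ h
    simp only [Finset.mem_product, Finset.mem_range, piPerm_apply] at *
    split_ifs <;> omega
  · have : (completeEdges n).filter (fun p => ¬ 1 ≤ p.1) =
        (Finset.Ico 1 n).image (fun j => (0, j)) := by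
      ext ⟨i, j⟩
      simp only [Finset.mem_filter, mem_completeEdges, Finset.mem_image, Finset.mem_Ico,
        Prod.mk.injEq]
      constructor
      · rintro h; exact ⟨j, by omega, by omega, rfl⟩
      · rintro ⟨j, h, rfl, rfl⟩; omega
    rw [this, Finset.card_image_of_injective _ (fun _ _ h => (Prod.mk.inj h).2), Nat.card_Ico]

lemma card_boxes (n : ℕ) : (boxes n).card = permLen n (piPerm n) + (n - 1) := by
  rw [← card_completeEdges, ← image_boxes, Finset.card_image_of_injOn (boxEdge_injOn n)]

lemma noncrossing_alternating_iff {n : ℕ} {E : Finset (ℕ × ℕ)} (hE : E ⊆ boxes n) :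
    Noncrossing (E.image (boxEdge n)) ∧ Alternating (E.image (boxEdge n)) ↔
      ∀ b ∈ E, ∀ b' ∈ E, ¬ Conflict n b b' := by
  constructor
  · rintro ⟨hnc, halt⟩ ⟨r, c⟩ hb ⟨r', c'⟩ hb' ⟨h1, h2, h3⟩
    have h := mem_boxes.1 (hE hb)
    have h' := mem_boxes.1 (hE hb')
    have e := Finset.mem_image_of_mem (boxEdge n) hb
    have e' := Finset.mem_image_of_mem (boxEdge n) hb'
    simp only [boxEdge] at h1 h2 h3 h h' e e'
    rcases Nat.lt_or_ge c' (n - 1 - r) with hlt | hge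
    · exact hnc ⟨c, c', n - 1 - r, n - 1 - r', h1, hlt, by omega, e, e'⟩
    · obtain rfl : c' = n - 1 - r := by omega
      exact halt ⟨c, n - 1 - r, n - 1 - r', h1, by omega, e, e'⟩
  · intro h
    refine ⟨?_, ?_⟩
    · rintro ⟨i, j, k, l, hij, hjk, hkl, h1, h2⟩
      obtain ⟨⟨r, c⟩, hb, hbe⟩ := Finset.mem_image.1 h1
      obtain ⟨⟨r', c'⟩, hb', hbe'⟩ := Finset.mem_image.1 h2
      simp only [boxEdge, Prod.mk.injEq] at hbe hbe'
      refine h _ hb _ hb' ⟨?_, ?_, ?_⟩ <;> simp only <;> omega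
    · rintro ⟨i, j, k, hij, hjk, h1, h2⟩
      obtain ⟨⟨r, c⟩, hb, hbe⟩ := Finset.mem_image.1 h1
      obtain ⟨⟨r', c'⟩, hb', hbe'⟩ := Finset.mem_image.1 h2
      simp only [boxEdge, Prod.mk.injEq] at hbe hbe'
      refine h _ hb _ hb' ⟨?_, ?_, ?_⟩ <;> simp only <;> omega

lemma isNATree_image_sdiff {n : ℕ} (hn : 1 ≤ n) {P : Finset (ℕ × ℕ)}
    (hP : IsReducedPipeDream n (piPerm n) P) :
    IsNATree n ((boxes n \ P).image (boxEdge n)) := by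
  obtain ⟨⟨hsub, hd⟩, hcard⟩ := hP
  obtain ⟨hnc, halt⟩ := (noncrossing_alternating_iff Finset.sdiff_subset).2
    fun b hb b' hb' => not_conflict_of_demazure hd (Finset.mem_sdiff.1 hb).2
      (Finset.mem_sdiff.1 hb').2
  have hE : ∀ p ∈ (boxes n \ P).image (boxEdge n), p.1 < p.2 ∧ p.2 < n := fun p hp => by
    rw [← mem_completeEdges, ← image_boxes]
    exact Finset.image_subset_image Finset.sdiff_subset hp
  obtain ⟨T, hT, hs, hTc, -⟩ := exists_isNATree hn hE hnc halt
  rwa [Finset.eq_of_subset_of_card_le hs]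
  rw [hTc, Finset.card_image_of_injOn
    ((boxEdge_injOn n).mono (Finset.coe_subset.2 Finset.sdiff_subset)),
    Finset.card_sdiff_of_subset hsub, card_boxes, hcard]
  omega

lemma exists_isReducedPipeDream {n : ℕ} (hn : 2 ≤ n) {T : Finset (ℕ × ℕ)} (hT : IsNATree n T) :
    ∃ P, IsReducedPipeDream n (piPerm n) P ∧ (boxes n \ P).image (boxEdge n) = T := by
  obtain ⟨hcard, hroot⟩ := hT.card_and_root (by omega)
  have hTK : T ⊆ (boxes n).image (boxEdge n) := fun p hp => by
    rw [image_boxes, mem_completeEdges]; exact hT.1.1 p hp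
  obtain ⟨E, hE, rfl⟩ := Finset.subset_image_iff.1 hTK
  have hE : E ⊆ boxes n := Finset.coe_subset.1 hE
  have hsd : boxes n \ (boxes n \ E) = E := Finset.sdiff_sdiff_eq_self hE
  refine ⟨boxes n \ E, ⟨⟨Finset.sdiff_subset, demazure_eq_piPerm ?_ ?_⟩, ?_⟩, by rw [hsd]⟩
  · obtain ⟨b, hb, hbe⟩ := Finset.mem_image.1 (hroot hn)
    have := mem_boxes.1 (hE hb)
    obtain ⟨r, c⟩ := b
    simp only [boxEdge, Prod.mk.injEq] at hbe this
    obtain ⟨rfl, rfl⟩ : r = 0 ∧ c = 0 := by omega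
    simp [hb]
  · intro b hb b' hb' h h'
    simp only [Finset.mem_sdiff, hb, hb', true_and, not_not] at h h'
    exact (noncrossing_alternating_iff hE).1 hT.2 b h b' h'
  · rw [Finset.card_sdiff_of_subset hE, card_boxes]
    rw [Finset.card_image_of_injOn ((boxEdge_injOn n).mono (Finset.coe_subset.2 hE))] at hcard
    omega


/-! ### Flows and simplices -/

/-- `a` is a nonnegative combination of the vectors `e_i - e_j` over `T` representing `x`. -/
structure IsFlow (T : Finset (ℕ × ℕ)) (a : ℕ × ℕ → ℝ) (x : ℕ → ℝ) : Prop where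
  nonneg : ∀ e, 0 ≤ a e
  eq_zero : ∀ e, e ∉ T → a e = 0
  sum_eq : ∑ e ∈ T, a e • rvec e = x

lemma IsFlow.mono {T T' : Finset (ℕ × ℕ)} {a : ℕ × ℕ → ℝ} {x : ℕ → ℝ} (h : IsFlow T a x)
    (hT : T ⊆ T') : IsFlow T' a x where
  nonneg := h.nonneg
  eq_zero e he := h.eq_zero e fun h' => he (hT h')
  sum_eq := by
    rw [← h.sum_eq]
    exact (Finset.sum_subset hT fun e _ he => by rw [h.eq_zero e he, zero_smul]).symm

lemma IsFlow.restrict {T T' : Finset (ℕ × ℕ)} {a : ℕ × ℕ → ℝ} {x : ℕ → ℝ} (h : IsFlow T a x)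
    (hT : T' ⊆ T) (ha : ∀ e, e ∉ T' → a e = 0) : IsFlow T' a x where
  nonneg := h.nonneg
  eq_zero := ha
  sum_eq := by
    rw [← h.sum_eq]
    exact Finset.sum_subset hT fun e _ he => by rw [ha e he, zero_smul]

lemma sum_single_smul {M : Type*} [AddCommGroup M] [Module ℝ M] {T : Finset (ℕ × ℕ)} {p : ℕ × ℕ}
    (hp : p ∈ T) (v : ℕ × ℕ → M) :
    ∑ e ∈ T, (Pi.single p (1 : ℝ) : ℕ × ℕ → ℝ) e • v e = v p := by
  rw [Finset.sum_eq_single_of_mem p hp fun e _ he => by rw [Pi.single_eq_of_ne he, zero_smul],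
    Pi.single_eq_same, one_smul]

lemma mem_treeSimplex {T : Finset (ℕ × ℕ)} {x : ℕ → ℝ} :
    x ∈ treeSimplex T ↔ ∃ a, IsFlow T a x ∧ ∑ e ∈ T, a e ≤ 1 := by
  constructor
  · intro hx
    refine convexHull_min (t := {x | ∃ a, IsFlow T a x ∧ ∑ e ∈ T, a e ≤ 1}) ?_ ?_ hx
    · rintro y (rfl | ⟨e, he, rfl⟩)
      · exact ⟨0, ⟨fun _ => le_rfl, fun _ _ => rfl, by simp⟩, by simp⟩
      · refine ⟨Pi.single e 1, ⟨fun p => ?_, fun p hp => ?_, sum_single_smul he _⟩, ?_⟩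
        · by_cases h : p = e
          · simp [h]
          · rw [Pi.single_eq_of_ne h]
        · exact Pi.single_eq_of_ne (by rintro rfl; exact hp he) _
        · simpa using (sum_single_smul he (fun _ => (1 : ℝ))).le
    · rintro y ⟨a, ha, ha1⟩ z ⟨b, hb, hb1⟩ s t hs ht hst
      refine ⟨s • a + t • b, ⟨fun e => ?_, fun e he => ?_, ?_⟩, ?_⟩
      · exact add_nonneg (mul_nonneg hs (ha.nonneg e)) (mul_nonneg ht (hb.nonneg e))
      · simp [ha.eq_zero e he, hb.eq_zero e he]
      · rw [← ha.sum_eq, ← hb.sum_eq, Finset.smul_sum, Finset.smul_sum, ← Finset.sum_add_distrib]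
        refine Finset.sum_congr rfl fun e _ => ?_
        simp only [Pi.add_apply, Pi.smul_apply, smul_eq_mul, add_smul, mul_smul]
      · simp only [Pi.add_apply, Pi.smul_apply, smul_eq_mul, Finset.sum_add_distrib,
          ← Finset.mul_sum]
        nlinarith
  · rintro ⟨a, ha, ha1⟩
    have := (convex_convexHull ℝ ({0} ∪ rvec '' (T : Set (ℕ × ℕ)))).sum_mem
      (t := Finset.insertNone T) (w := fun o => o.elim (1 - ∑ e ∈ T, a e) a)
      (z := fun o => o.elim 0 rvec) ?_ ?_ ?_
    · rw [Finset.sum_insertNone] at this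
      simpa [ha.sum_eq, treeSimplex] using this
    · rintro (_ | e) _
      · simpa using ha1
      · exact ha.nonneg e
    · rw [Finset.sum_insertNone]
      simp
    · rintro (_ | e) he
      · exact subset_convexHull ℝ _ (Or.inl rfl)
      · exact subset_convexHull ℝ _ (Or.inr ⟨e, by simpa using he, rfl⟩)

lemma fullRootPolytope_eq (n : ℕ) : fullRootPolytope n = treeSimplex (completeEdges n) := by
  unfold fullRootPolytope treeSimplex
  congr 2
  ext v
  constructor
  · rintro ⟨i, j, hij, hj, rfl⟩
    exact ⟨(i, j), mem_completeEdges.2 ⟨hij, hj⟩, rfl⟩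
  · rintro ⟨⟨i, j⟩, h, rfl⟩
    have h := mem_completeEdges.1 h
    exact ⟨i, j, h.1, h.2, rfl⟩

lemma rvec_apply (e : ℕ × ℕ) (v : ℕ) :
    rvec e v = (if v = e.1 then 1 else 0) - (if v = e.2 then 1 else 0) := by
  simp only [rvec, Pi.sub_apply, Pi.single_apply]

lemma IsFlow.sum_mul_length {n : ℕ} {T : Finset (ℕ × ℕ)} (hT : T ⊆ completeEdges n)
    {a : ℕ × ℕ → ℝ} {x : ℕ → ℝ} (h : IsFlow T a x) :
    ∑ e ∈ T, a e * ((e.2 : ℝ) - e.1) = -∑ i ∈ Finset.range n, (i : ℝ) * x i := by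
  rw [← h.sum_eq]
  simp only [Finset.sum_apply, Finset.mul_sum]
  rw [Finset.sum_comm, ← Finset.sum_neg_distrib]
  refine Finset.sum_congr rfl fun e he => ?_
  have he := mem_completeEdges.1 (hT he)
  have h1 : e.1 ∈ Finset.range n := Finset.mem_range.2 (he.1.trans he.2)
  have h2 : e.2 ∈ Finset.range n := Finset.mem_range.2 he.2
  simp only [Pi.smul_apply, rvec_apply, smul_eq_mul, mul_sub, Finset.sum_sub_distrib, mul_ite,
    mul_one, mul_zero, Finset.sum_ite_eq', h1, h2, if_true]
  ring

lemma IsFlow.le_sum_mul_length {n : ℕ} {T : Finset (ℕ × ℕ)} (hT : T ⊆ completeEdges n)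
    {a : ℕ × ℕ → ℝ} {x : ℕ → ℝ} (h : IsFlow T a x) :
    ∑ e ∈ T, a e ≤ -∑ i ∈ Finset.range n, (i : ℝ) * x i := by
  rw [← h.sum_mul_length hT]
  refine Finset.sum_le_sum fun e he => le_mul_of_one_le_right (h.nonneg e) ?_
  have : ((e.1 + 1 : ℕ) : ℝ) ≤ e.2 := Nat.cast_le.2 (mem_completeEdges.1 (hT he)).1
  push_cast at this
  linarith

lemma mem_vertexFigure {n : ℕ} {x : ℕ → ℝ} :
    x ∈ vertexFigure n ↔ (∃ a, IsFlow (completeEdges n) a x) ∧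
      ∑ i ∈ Finset.range n, (i : ℝ) * x i = -(1/2 : ℝ) := by
  rw [vertexFigure, fullRootPolytope_eq, Set.mem_inter_iff, mem_treeSimplex, Set.mem_ofPred_eq]
  refine and_congr_left fun hx => exists_congr fun a => and_iff_left_of_imp fun ha => ?_
  have := ha.le_sum_mul_length subset_rfl
  linarith

lemma mem_vfSimplex {n : ℕ} {T : Finset (ℕ × ℕ)} (hT : T ⊆ completeEdges n) {x : ℕ → ℝ} :
    x ∈ vfSimplex n T ↔ (∃ a, IsFlow T a x) ∧
      ∑ i ∈ Finset.range n, (i : ℝ) * x i = -(1/2 : ℝ) := by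
  rw [vfSimplex, Set.mem_inter_iff, mem_treeSimplex, mem_vertexFigure]
  constructor
  · rintro ⟨⟨a, ha, -⟩, -, hx⟩
    exact ⟨⟨a, ha⟩, hx⟩
  · rintro ⟨⟨a, ha⟩, hx⟩
    have := ha.le_sum_mul_length hT
    exact ⟨⟨a, ha, by linarith⟩, ⟨a, ha.mono hT⟩, hx⟩

/-- Exchanging the edges `p`, `q` for `f` cannot increase the second moment of a maximal flow. -/
lemma IsFlow.not_exchange {K : Finset (ℕ × ℕ)} {a : ℕ × ℕ → ℝ} {x : ℕ → ℝ} {φ : ℕ × ℕ → ℝ}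
    (h : IsFlow K a x) (hmax : ∀ b, IsFlow K b x → ∑ e ∈ K, b e • φ e ≤ ∑ e ∈ K, a e • φ e)
    {p q : ℕ × ℕ} (hpq : p ≠ q) (hp : 0 < a p) (hq : 0 < a q) {f : ℕ × ℕ → ℝ}
    (hf : ∀ e, 0 ≤ f e) (hfK : ∀ e, e ∉ K → f e = 0)
    (hfr : ∑ e ∈ K, f e • rvec e = rvec p + rvec q) :
    ∑ e ∈ K, f e • φ e ≤ φ p + φ q := by
  have hpK : p ∈ K := by by_contra hc; exact hp.ne' (h.eq_zero p hc)
  have hqK : q ∈ K := by by_contra hc; exact hq.ne' (h.eq_zero q hc)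
  obtain ⟨ε, hε, hεp, hεq⟩ : ∃ ε, 0 < ε ∧ ε ≤ a p ∧ ε ≤ a q :=
    ⟨min (a p) (a q), lt_min hp hq, min_le_left _ _, min_le_right _ _⟩
  set b : ℕ × ℕ → ℝ := fun e => a e + ε * (f e - (Pi.single p (1 : ℝ) : ℕ × ℕ → ℝ) e -
    (Pi.single q (1 : ℝ) : ℕ × ℕ → ℝ) e) with hb
  have key : ∀ {M : Type} [AddCommGroup M] [Module ℝ M] (v : ℕ × ℕ → M),
      ∑ e ∈ K, b e • v e = ∑ e ∈ K, a e • v e + ε • (∑ e ∈ K, f e • v e - v p - v q) := by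
    intro M _ _ v
    conv_rhs => rw [← sum_single_smul hpK v, ← sum_single_smul hqK v]
    simp only [hb, add_smul, mul_smul, sub_smul, Finset.sum_add_distrib, Finset.smul_sum,
      Finset.sum_sub_distrib, smul_sub]
  have hbf : IsFlow K b x := by
    refine ⟨fun e => ?_, fun e he => ?_, ?_⟩
    · have hfe := mul_nonneg hε.le (hf e)
      have hae := h.nonneg e
      simp only [hb]
      by_cases hep : e = p
      · subst hep
        rw [Pi.single_eq_same, Pi.single_eq_of_ne hpq]
        nlinarith
      · by_cases heq : e = q
        · subst heq
          rw [Pi.single_eq_same, Pi.single_eq_of_ne hep]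
          nlinarith
        · rw [Pi.single_eq_of_ne hep, Pi.single_eq_of_ne heq]
          nlinarith
    · simp only [hb]
      rw [h.eq_zero e he, hfK e he, Pi.single_eq_of_ne (by rintro rfl; exact he hpK),
        Pi.single_eq_of_ne (by rintro rfl; exact he hqK)]
      simp
    · rw [key, h.sum_eq, hfr]
      simp
  have := hmax b hbf
  rw [key] at this
  simp only [smul_eq_mul] at this ⊢
  by_contra hc
  have := mul_pos hε (show 0 < ∑ e ∈ K, f e * φ e - φ p - φ q by linarith)
  linarith

lemma IsFlow.exists_max {n : ℕ} {a : ℕ × ℕ → ℝ} {x : ℕ → ℝ} (h : IsFlow (completeEdges n) a x)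
    (φ : ℕ × ℕ → ℝ) : ∃ b, IsFlow (completeEdges n) b x ∧ ∀ c, IsFlow (completeEdges n) c x →
      ∑ e ∈ completeEdges n, c e • φ e ≤ ∑ e ∈ completeEdges n, b e • φ e := by
  set M := -∑ i ∈ Finset.range n, (i : ℝ) * x i
  have hclosed : IsClosed {b | IsFlow (completeEdges n) b x} := by
    have : {b | IsFlow (completeEdges n) b x} = {b | ∀ e, 0 ≤ b e} ∩
        ({b | ∀ e, e ∉ completeEdges n → b e = 0} ∩
          {b | ∑ e ∈ completeEdges n, b e • rvec e = x}) := by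
      ext b
      exact ⟨fun h => ⟨h.1, h.2, h.3⟩, fun h => ⟨h.1, h.2.1, h.2.2⟩⟩
    rw [this]
    refine IsClosed.inter ?_ (IsClosed.inter ?_ ?_)
    · simp only [Set.ofPred_forall]
      exact isClosed_iInter fun e => isClosed_le continuous_const (continuous_apply e)
    · simp only [Set.ofPred_forall]
      exact isClosed_iInter fun e => isClosed_iInter fun _ =>
        isClosed_eq (continuous_apply e) continuous_const
    · exact isClosed_eq (by fun_prop) continuous_const
  have hcompact : IsCompact {b | IsFlow (completeEdges n) b x} := by
    refine (isCompact_univ_pi fun _ : ℕ × ℕ => isCompact_Icc (a := (0 : ℝ)) (b := M)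
      ).of_isClosed_subset hclosed fun b hb e _ => ⟨hb.nonneg e, ?_⟩
    refine le_trans ?_ (hb.le_sum_mul_length subset_rfl)
    by_cases he : e ∈ completeEdges n
    · exact Finset.single_le_sum (fun e _ => hb.nonneg e) he
    · rw [hb.eq_zero e he]
      exact Finset.sum_nonneg fun e _ => hb.nonneg e
  obtain ⟨b, hb, hmax⟩ := hcompact.exists_isMaxOn ⟨a, h⟩
    (f := fun b : ℕ × ℕ → ℝ => ∑ e ∈ completeEdges n, b e • φ e)
    (Continuous.continuousOn (by fun_prop))
  exact ⟨b, hb, fun c hc => hmax hc⟩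

lemma IsFlow.exists_noncrossing_alternating {n : ℕ} {a : ℕ × ℕ → ℝ} {x : ℕ → ℝ}
    (h : IsFlow (completeEdges n) a x) :
    ∃ F ⊆ completeEdges n, Noncrossing F ∧ Alternating F ∧ ∃ b, IsFlow F b x := by
  obtain ⟨b, hb, hmax⟩ := h.exists_max fun e => ((e.2 : ℝ) - e.1) ^ 2
  have hs : ∀ p q : ℕ × ℕ, 0 ≤ (Pi.single p (1 : ℝ) : ℕ × ℕ → ℝ) q := fun p q => by
    rw [Pi.single_apply]
    split_ifs <;> norm_num
  have hz : ∀ p ∈ completeEdges n, ∀ q ∉ completeEdges n,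
      (Pi.single p (1 : ℝ) : ℕ × ℕ → ℝ) q = 0 := fun p hp q hq =>
    Pi.single_eq_of_ne (by rintro rfl; exact hq hp) _
  refine ⟨(completeEdges n).filter fun e => 0 < b e, Finset.filter_subset _ _, ?_, ?_, b,
    hb.restrict (Finset.filter_subset _ _) fun e he => ?_⟩
  · rintro ⟨i, j, k, l, hij, hjk, hkl, h1, h2⟩
    rw [Finset.mem_filter, mem_completeEdges] at h1 h2
    have hil : (i, l) ∈ completeEdges n := mem_completeEdges.2 ⟨by simp only; omega, h2.1.2⟩
    have hjk' : (j, k) ∈ completeEdges n := mem_completeEdges.2 ⟨hjk, h1.1.2⟩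
    have := hb.not_exchange hmax (p := (i, k)) (q := (j, l)) (by simp; omega) h1.2 h2.2
      (f := Pi.single (i, l) 1 + Pi.single (j, k) 1) (fun e => add_nonneg (hs _ e) (hs _ e))
      (fun e he => by rw [Pi.add_apply, hz _ hil e he, hz _ hjk' e he, add_zero])
      (by
        simp only [Pi.add_apply, add_smul, Finset.sum_add_distrib, sum_single_smul hil,
          sum_single_smul hjk']
        simp only [rvec]
        abel)
    simp only [Pi.add_apply, add_smul, Finset.sum_add_distrib, sum_single_smul hil,
      sum_single_smul hjk'] at this
    have hij : (i : ℝ) < j := Nat.cast_lt.2 hij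
    have hkl : (k : ℝ) < l := Nat.cast_lt.2 hkl
    nlinarith [mul_pos (sub_pos.2 hij) (sub_pos.2 hkl)]
  · rintro ⟨i, j, k, hij, hjk, h1, h2⟩
    rw [Finset.mem_filter, mem_completeEdges] at h1 h2
    have hik : (i, k) ∈ completeEdges n := mem_completeEdges.2 ⟨by simp only; omega, h2.1.2⟩
    have := hb.not_exchange hmax (p := (i, j)) (q := (j, k)) (by simp; omega) h1.2 h2.2
      (f := Pi.single (i, k) 1) (hs _) (hz _ hik)
      (by
        rw [sum_single_smul hik]
        simp only [rvec]
        abel)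
    rw [sum_single_smul hik] at this
    simp only at this
    have hij : (i : ℝ) < j := Nat.cast_lt.2 hij
    have hjk : (j : ℝ) < k := Nat.cast_lt.2 hjk
    nlinarith [mul_pos (sub_pos.2 hij) (sub_pos.2 hjk)]
  · by_cases hK : e ∈ completeEdges n
    · rw [Finset.mem_filter, not_and, not_lt] at he
      exact le_antisymm (he hK) (hb.nonneg e)
    · exact hb.eq_zero e hK

lemma IsFlow.apply_eq {n : ℕ} {a : ℕ × ℕ → ℝ} {x : ℕ → ℝ} (h : IsFlow (completeEdges n) a x)
    {v : ℕ} (hv : v < n) :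
    x v = ∑ w ∈ Finset.range n, a (v, w) - ∑ u ∈ Finset.range n, a (u, v) := by
  have hK : completeEdges n ⊆ Finset.range n ×ˢ Finset.range n := fun p hp => by
    have := mem_completeEdges.1 hp
    simp only [Finset.mem_product, Finset.mem_range]
    omega
  rw [← (h.mono hK).sum_eq, Finset.sum_apply, Finset.sum_product]
  simp only [Pi.smul_apply, rvec_apply, smul_eq_mul, mul_sub, Finset.sum_sub_distrib, mul_ite,
    mul_one, mul_zero]
  congr 1
  · rw [Finset.sum_comm]
    simp [hv]
  · simp [hv]

lemma IsFlow.out_eq_max {n : ℕ} {F : Finset (ℕ × ℕ)} (hF : F ⊆ completeEdges n)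
    (halt : Alternating F) {a : ℕ × ℕ → ℝ} {x : ℕ → ℝ} (h : IsFlow F a x) {v : ℕ} (hv : v < n) :
    ∑ w ∈ Finset.range n, a (v, w) = max (x v) 0 ∧
      ∑ u ∈ Finset.range n, a (u, v) = max (-x v) 0 := by
  have hx := (h.mono hF).apply_eq hv
  have hin : 0 ≤ ∑ u ∈ Finset.range n, a (u, v) := Finset.sum_nonneg fun _ _ => h.nonneg _
  have hout : 0 ≤ ∑ w ∈ Finset.range n, a (v, w) := Finset.sum_nonneg fun _ _ => h.nonneg _
  have hF' : ∀ e, a e ≠ 0 → e ∈ F := fun e he => by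
    by_contra hc
    exact he (h.eq_zero e hc)
  have h0 : ∑ w ∈ Finset.range n, a (v, w) = 0 ∨ ∑ u ∈ Finset.range n, a (u, v) = 0 := by
    by_contra! hc
    obtain ⟨w, -, hw⟩ := Finset.exists_ne_zero_of_sum_ne_zero hc.1
    obtain ⟨u, -, hu⟩ := Finset.exists_ne_zero_of_sum_ne_zero hc.2
    exact halt ⟨u, v, w, (mem_completeEdges.1 (hF (hF' _ hu))).1,
      (mem_completeEdges.1 (hF (hF' _ hw))).1, hF' _ hu, hF' _ hw⟩
  rcases h0 with h0 | h0 <;> rw [h0] at hx ⊢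
  · rw [max_eq_right (by linarith), max_eq_left (by linarith)]
    exact ⟨rfl, by linarith⟩
  · rw [max_eq_left (by linarith), max_eq_right (by linarith)]
    exact ⟨by linarith, rfl⟩

lemma exists_lt_of_sum_eq_of_lt {s : Finset ℕ} {f g : ℕ → ℝ} (h : ∑ i ∈ s, f i = ∑ i ∈ s, g i)
    {i : ℕ} (hi : i ∈ s) (hlt : g i < f i) : ∃ j, f j < g j := by
  by_contra! hc
  exact (Finset.sum_lt_sum (fun j _ => hc j) ⟨i, hi, hlt⟩).ne' h

lemma IsFlow.le_of_minimal {n : ℕ} {F₁ F₂ : Finset (ℕ × ℕ)} (hF₁ : F₁ ⊆ completeEdges n)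
    (hF₂ : F₂ ⊆ completeEdges n) (halt₁ : Alternating F₁) (halt₂ : Alternating F₂)
    (hnc : Noncrossing F₂) {a b : ℕ × ℕ → ℝ} {x : ℕ → ℝ} (ha : IsFlow F₁ a x) (hb : IsFlow F₂ b x)
    {e : ℕ × ℕ} (hmin : ∀ p, a p ≠ b p → e.2 - e.1 ≤ p.2 - p.1) : a e ≤ b e := by
  by_contra! hlt
  have heF : e ∈ F₁ := by
    by_contra hc
    rw [ha.eq_zero e hc] at hlt
    exact hlt.not_ge (hb.nonneg e)
  have hF' : ∀ p, a p < b p → p ∈ F₂ := fun p hp => by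
    by_contra hc
    rw [hb.eq_zero p hc] at hp
    exact hp.not_ge (ha.nonneg p)
  obtain ⟨i, j⟩ := e
  obtain ⟨hij, hj⟩ := mem_completeEdges.1 (hF₁ heF)
  simp only at hij hj hmin
  have hi : i < n := hij.trans hj
  obtain ⟨j', hj'⟩ := exists_lt_of_sum_eq_of_lt
    (((ha.out_eq_max hF₁ halt₁ hi).1).trans ((hb.out_eq_max hF₂ halt₂ hi).1).symm)
    (Finset.mem_range.2 hj) hlt
  obtain ⟨i', hi'⟩ := exists_lt_of_sum_eq_of_lt
    (((ha.out_eq_max hF₁ halt₁ hj).2).trans ((hb.out_eq_max hF₂ halt₂ hj).2).symm)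
    (Finset.mem_range.2 hi) hlt
  have h1 := mem_completeEdges.1 (hF₂ (hF' _ hj'))
  have h2 := mem_completeEdges.1 (hF₂ (hF' _ hi'))
  have h3 := hmin _ hj'.ne
  have h4 := hmin _ hi'.ne
  have hne1 : j' ≠ j := by rintro rfl; exact lt_asymm hlt hj'
  have hne2 : i' ≠ i := by rintro rfl; exact lt_asymm hlt hi'
  simp only at h1 h2 h3 h4
  exact hnc ⟨i', i, j, j', by omega, hij, by omega, hF' _ hi', hF' _ hj'⟩

lemma IsFlow.unique {n : ℕ} {F₁ F₂ : Finset (ℕ × ℕ)} (hF₁ : F₁ ⊆ completeEdges n)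
    (hF₂ : F₂ ⊆ completeEdges n) (halt₁ : Alternating F₁) (halt₂ : Alternating F₂)
    (hnc₁ : Noncrossing F₁) (hnc₂ : Noncrossing F₂) {a b : ℕ × ℕ → ℝ} {x : ℕ → ℝ}
    (ha : IsFlow F₁ a x) (hb : IsFlow F₂ b x) : a = b := by
  by_contra hne
  obtain ⟨e, he, hmin⟩ := (measure fun e : ℕ × ℕ => e.2 - e.1).wf.has_min {e | a e ≠ b e}
    (Function.ne_iff.1 hne)
  have hmin : ∀ p, a p ≠ b p → e.2 - e.1 ≤ p.2 - p.1 := fun p hp => not_lt.1 (hmin p hp)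
  exact he (le_antisymm (ha.le_of_minimal hF₁ hF₂ halt₁ halt₂ hnc₂ hb hmin)
    (hb.le_of_minimal hF₂ hF₁ halt₂ halt₁ hnc₁ ha fun p hp => hmin p hp.symm))

lemma image_boxEdge_subset_iff {n : ℕ} {F G : Finset (ℕ × ℕ)} (hF : F ⊆ boxes n)
    (hG : G ⊆ boxes n) : F.image (boxEdge n) ⊆ G.image (boxEdge n) ↔ F ⊆ G := by
  refine ⟨fun h b hb => ?_, Finset.image_subset_image⟩
  obtain ⟨c, hc, hcb⟩ := Finset.mem_image.1 (h (Finset.mem_image_of_mem _ hb))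
  rwa [← boxEdge_injOn n (hG hc) (hF hb) hcb]

lemma image_boxEdge_inj {n : ℕ} {F G : Finset (ℕ × ℕ)} (hF : F ⊆ boxes n) (hG : G ⊆ boxes n)
    (h : F.image (boxEdge n) = G.image (boxEdge n)) : F = G :=
  ((image_boxEdge_subset_iff hF hG).1 h.subset).antisymm
    ((image_boxEdge_subset_iff hG hF).1 h.superset)

lemma vfSimplex_inter {n : ℕ} {F₁ F₂ : Finset (ℕ × ℕ)} (hF₁ : F₁ ⊆ completeEdges n)
    (hF₂ : F₂ ⊆ completeEdges n) (halt₁ : Alternating F₁) (halt₂ : Alternating F₂)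
    (hnc₁ : Noncrossing F₁) (hnc₂ : Noncrossing F₂) :
    vfSimplex n F₁ ∩ vfSimplex n F₂ = vfSimplex n (F₁ ∩ F₂) := by
  ext x
  rw [Set.mem_inter_iff, mem_vfSimplex hF₁, mem_vfSimplex hF₂,
    mem_vfSimplex (Finset.inter_subset_left.trans hF₁)]
  constructor
  · rintro ⟨⟨⟨a, ha⟩, hx⟩, ⟨b, hb⟩, -⟩
    obtain rfl := ha.unique hF₁ hF₂ halt₁ halt₂ hnc₁ hnc₂ hb
    refine ⟨⟨a, ha.restrict Finset.inter_subset_left fun e he => ?_⟩, hx⟩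
    by_cases h : e ∈ F₁
    · exact hb.eq_zero e fun h' => he (Finset.mem_inter.2 ⟨h, h'⟩)
    · exact ha.eq_zero e h
  · rintro ⟨⟨a, ha⟩, hx⟩
    exact ⟨⟨⟨a, ha.mono Finset.inter_subset_left⟩, hx⟩, ⟨a, ha.mono Finset.inter_subset_right⟩, hx⟩

lemma IsPDFace.exists_isNATree {n : ℕ} (hn : 1 ≤ n) {F : Finset (ℕ × ℕ)}
    (hF : IsPDFace n (piPerm n) F) : ∃ T, IsNATree n T ∧ F.image (boxEdge n) ⊆ T := by
  obtain ⟨hFb, P, hP, hPF⟩ := hF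
  exact ⟨_, isNATree_image_sdiff hn hP,
    Finset.image_subset_image (Finset.subset_sdiff.2 ⟨hFb, hPF.symm⟩)⟩

lemma vfSimplex_image_inter {n : ℕ} (hn : 1 ≤ n) {F₁ F₂ : Finset (ℕ × ℕ)}
    (hF₁ : IsPDFace n (piPerm n) F₁) (hF₂ : IsPDFace n (piPerm n) F₂) :
    vfSimplex n (F₁.image (boxEdge n)) ∩ vfSimplex n (F₂.image (boxEdge n)) =
      vfSimplex n ((F₁ ∩ F₂).image (boxEdge n)) := by
  have hK : ∀ F, IsPDFace n (piPerm n) F → F.image (boxEdge n) ⊆ completeEdges n := fun F hF => by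
    rw [← image_boxes]
    exact Finset.image_subset_image hF.1
  obtain ⟨T₁, ⟨-, hnc₁, halt₁⟩, h₁⟩ := hF₁.exists_isNATree hn
  obtain ⟨T₂, ⟨-, hnc₂, halt₂⟩, h₂⟩ := hF₂.exists_isNATree hn
  rw [vfSimplex_inter (hK _ hF₁) (hK _ hF₂) (halt₁.mono h₁) (halt₂.mono h₂) (hnc₁.mono h₁)
    (hnc₂.mono h₂), Finset.image_inter_of_injOn]
  rw [← Finset.coe_union]
  exact (boxEdge_injOn n).mono (Finset.coe_subset.2 (Finset.union_subset hF₁.1 hF₂.1))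

lemma iUnion_vfSimplex {n : ℕ} (hn : 2 ≤ n) :
    (⋃ P ∈ {P | IsReducedPipeDream n (piPerm n) P},
      vfSimplex n ((boxes n \ P).image (boxEdge n))) = vertexFigure n := by
  refine Set.Subset.antisymm (Set.iUnion₂_subset fun _ _ => Set.inter_subset_right) fun x hx => ?_
  obtain ⟨⟨a, ha⟩, hx⟩ := mem_vertexFigure.1 hx
  obtain ⟨F, hF, hnc, halt, b, hb⟩ := ha.exists_noncrossing_alternating
  obtain ⟨T, hT, hFT, -⟩ := exists_isNATree (by omega)
    (fun p hp => mem_completeEdges.1 (hF hp)) hnc halt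
  obtain ⟨P, hP, rfl⟩ := exists_isReducedPipeDream hn hT
  exact Set.mem_iUnion₂.2 ⟨P, hP, (mem_vfSimplex fun p hp =>
    mem_completeEdges.2 (hT.1.1 p hp)).2 ⟨⟨b, hb.mono hFT⟩, hx⟩⟩

lemma bijOn_reducedPipeDreams {n : ℕ} (hn : 2 ≤ n) :
    Set.BijOn (fun P => (boxes n \ P).image (boxEdge n)) {P | IsReducedPipeDream n (piPerm n) P}
      {T | IsNATree n T} := by
  refine ⟨fun P hP => isNATree_image_sdiff (by omega) hP, fun P hP Q hQ h => ?_, fun T hT => ?_⟩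
  · have h := image_boxEdge_inj Finset.sdiff_subset Finset.sdiff_subset h
    rw [← Finset.sdiff_sdiff_eq_self hP.1.1, h, Finset.sdiff_sdiff_eq_self hQ.1.1]
  · obtain ⟨P, hP, h⟩ := exists_isReducedPipeDream hn hT
    exact ⟨P, hP, h⟩

lemma bijOn_faces {n : ℕ} (hn : 2 ≤ n) :
    Set.BijOn (fun F => F.image (boxEdge n)) {F | IsPDFace n (piPerm n) F}
      {F | ∃ T, IsNATree n T ∧ F ⊆ T} := by
  refine ⟨fun F hF => hF.exists_isNATree (by omega), fun F hF G hG h => ?_, ?_⟩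
  · exact image_boxEdge_inj hF.1 hG.1 h
  · rintro F ⟨T, hT, hFT⟩
    obtain ⟨P, hP, rfl⟩ := exists_isReducedPipeDream hn hT
    obtain ⟨G, hG, rfl⟩ := Finset.subset_image_iff.1 hFT
    have hG := Finset.subset_sdiff.1 hG
    exact ⟨G, ⟨hG.1, P, hP, hG.2.symm⟩, rfl⟩
/-- The pipe dream complex `PD(1 n (n-1) ⋯ 2)` is geometrically realized
by the canonical triangulation of the vertex figure `V(P_n)` of the root polytope `P(P_n)`
at `0`: the elbow-to-edge map is a bijection from reduced pipe dreams onto noncrossing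
alternating spanning trees of `K_n`, the induced map on faces is an inclusion-preserving
bijection from the faces of `PD(1 n (n-1) ⋯ 2)` onto the faces of the canonical
triangulation of `V(P_n)`, and the corresponding geometric simplices `treeSimplex ∩ V(P_n)`
cover `V(P_n)` and intersect along the simplices of common subgraphs. -/
theorem pipeDreamComplex_realization (n : ℕ) (hn : 2 ≤ n) :
    -- bijection between reduced pipe dreams and noncrossing alternating spanning trees
    Set.BijOn (fun P => (boxes n \ P).image (boxEdge n))
      {P | IsReducedPipeDream n (piPerm n) P}
      {T | IsSpanningTree n T ∧ Noncrossing T ∧ Alternating T} ∧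
    -- induced simplicial isomorphism on the face posets
    Set.BijOn (fun F => F.image (boxEdge n))
      {F | IsPDFace n (piPerm n) F}
      {F | ∃ T, (IsSpanningTree n T ∧ Noncrossing T ∧ Alternating T) ∧ F ⊆ T} ∧
    (∀ F₁ F₂ : Finset (ℕ × ℕ), IsPDFace n (piPerm n) F₁ → IsPDFace n (piPerm n) F₂ →
      (F₁ ⊆ F₂ ↔ F₁.image (boxEdge n) ⊆ F₂.image (boxEdge n))) ∧
    -- geometric realization: the corresponding simplices triangulate the vertex figure
    (⋃ P ∈ {P | IsReducedPipeDream n (piPerm n) P},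
        vfSimplex n ((boxes n \ P).image (boxEdge n))) = vertexFigure n ∧
    (∀ F₁ F₂ : Finset (ℕ × ℕ), IsPDFace n (piPerm n) F₁ → IsPDFace n (piPerm n) F₂ →
      vfSimplex n (F₁.image (boxEdge n)) ∩ vfSimplex n (F₂.image (boxEdge n)) =
        vfSimplex n ((F₁ ∩ F₂).image (boxEdge n))) := by
  exact ⟨bijOn_reducedPipeDreams hn, bijOn_faces hn,
    fun F₁ F₂ h₁ h₂ => (image_boxEdge_subset_iff h₁.1 h₂.1).symm, iUnion_vfSimplex hn,
    fun F₁ F₂ h₁ h₂ => vfSimplex_image_inter (by omega) h₁ h₂⟩
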